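/- Let G = PSL(2,ℤ) with r, u, S = {r, u, u⁻¹} as above, and let a ∈ {u, u⁻¹} with ā = a⁻¹. If g ∈ G satisfies 𝐒₂*(g) = {ra, aa}, then S⁺(g) = {r, a}, 𝐒₂*(g·r) = {ar, rā}, and 𝐒₂*(g·a) = {aa}. -/

import Mathlib

namespace PSL2Z

abbrev SL2Z : Type := Matrix.SpecialLinearGroup (Fin 2) ℤ

/-- `PSL(2,ℤ)`: the quotient of `SL(2,ℤ)` by its center `{±I}`. -/
abbrev G : Type := SL2Z ⧸ Subgroup.center SL2Z

/-- The image in `PSL(2,ℤ)` of the matrix `[[0,1],[-1,0]]`. -/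
def r : G := QuotientGroup.mk (⟨!![0, 1; -1, 0], by norm_num [Matrix.det_fin_two_of]⟩ : SL2Z)

/-- The image in `PSL(2,ℤ)` of the matrix `[[1,1],[0,1]]`. -/
def u : G := QuotientGroup.mk (⟨!![1, 1; 0, 1], by norm_num [Matrix.det_fin_two_of]⟩ : SL2Z)

/-- The symmetric generating set `S = {r, u, u⁻¹}`. -/
def S : Set G := {r, u, u⁻¹}

/-- A word in `S`: a finite list of elements of `S`. -/
def IsWord (w : List G) : Prop := ∀ x ∈ w, x ∈ S

/-- The word norm `|g|`: the least length of a word in `S` representing `g`. -/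
noncomputable def wordNorm (g : G) : ℕ :=
  sInf {n | ∃ w : List G, IsWord w ∧ w.prod = g ∧ w.length = n}

/-- A geodesic for `g`: a word in `S` representing `g` of length `|g|`. -/
def IsGeodesic (g : G) (w : List G) : Prop :=
  IsWord w ∧ w.prod = g ∧ w.length = wordNorm g

/-- `𝐒ₙ(g)`: the set of suffixes of length `n` of geodesics for `g`. -/
def Suf (n : ℕ) (g : G) : Set (List G) :=
  {v | v.length = n ∧ ∃ w : List G, IsGeodesic g w ∧ v <:+ w}

open Classical in
/-- `𝐒₂*(g)`: `𝐒₂(g)` if nonempty, otherwise `𝐒₁(g)` (which is `∅` exactly when `g = 1`). -/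
noncomputable def Suf2Star (g : G) : Set (List G) :=
  if (Suf 2 g).Nonempty then Suf 2 g else Suf 1 g

/-- `S⁺(g) = {s ∈ S : |g·s| = |g| + 1}`. -/
def Splus (g : G) : Set G := {s ∈ S | wordNorm (g * s) = wordNorm g + 1}

/-! ### Matrix representatives of the generators -/

/-- The matrix `[[0, 1], [-1, 0]]`. -/
def matR : SL2Z := ⟨!![0, 1; -1, 0], by norm_num [Matrix.det_fin_two_of]⟩

/-- The matrix `[[1, 1], [0, 1]]`. -/
def matU : SL2Z := ⟨!![1, 1; 0, 1], by norm_num [Matrix.det_fin_two_of]⟩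

theorem coe_matR : (matR : Matrix (Fin 2) (Fin 2) ℤ) = !![0, 1; -1, 0] := rfl

theorem coe_matU : (matU : Matrix (Fin 2) (Fin 2) ℤ) = !![1, 1; 0, 1] := rfl

/-! ### The Gram invariant -/

/-- The entries `(x, y, z)` of the Gram matrix `AᵀA = [[x, y], [y, z]]`. -/
def gramSL (A : SL2Z) : ℤ × ℤ × ℤ :=
  (A 0 0 ^ 2 + A 1 0 ^ 2, A 0 0 * A 0 1 + A 1 0 * A 1 1, A 0 1 ^ 2 + A 1 1 ^ 2)

theorem gramSL_mul_center (A C : SL2Z) (hC : C ∈ Subgroup.center SL2Z) :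
    gramSL (A * C) = gramSL A := by
  obtain ⟨t, ht, htC⟩ := Matrix.SpecialLinearGroup.mem_center_iff.1 hC
  have ht2 : t ^ 2 = 1 := by simpa using ht
  have h00 : C 0 0 = t := by
    rw [← htC, Matrix.scalar_apply, Matrix.diagonal_apply_eq]
  have h01 : C 0 1 = 0 := by
    rw [← htC, Matrix.scalar_apply, Matrix.diagonal_apply_ne _ (by decide)]
  have h10 : C 1 0 = 0 := by
    rw [← htC, Matrix.scalar_apply, Matrix.diagonal_apply_ne _ (by decide)]
  have h11 : C 1 1 = t := by
    rw [← htC, Matrix.scalar_apply, Matrix.diagonal_apply_eq]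
  simp only [gramSL, Matrix.SpecialLinearGroup.coe_mul, Matrix.mul_apply, Fin.sum_univ_two,
    h00, h01, h10, h11, Prod.mk.injEq]
  refine ⟨?_, ?_, ?_⟩
  · linear_combination (A 0 0 ^ 2 + A 1 0 ^ 2) * ht2
  · linear_combination (A 0 0 * A 0 1 + A 1 0 * A 1 1) * ht2
  · linear_combination (A 0 1 ^ 2 + A 1 1 ^ 2) * ht2

/-- The Gram matrix entries of an element of `PSL(2,ℤ)`. -/
def gram : G → ℤ × ℤ × ℤ :=
  Quotient.lift gramSL fun A B h => by
    have h' : A⁻¹ * B ∈ Subgroup.center SL2Z := QuotientGroup.leftRel_apply.1 h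
    simpa using (gramSL_mul_center A _ h').symm

theorem gram_one : gram 1 = (1, 0, 1) := by
  change gramSL 1 = _
  simp [gramSL]

theorem gram_mul_r (g : G) :
    gram (g * r) = ((gram g).2.2, -(gram g).2.1, (gram g).1) := by
  induction g using QuotientGroup.induction_on with
  | H A =>
    change gramSL (A * matR) = ((gramSL A).2.2, -(gramSL A).2.1, (gramSL A).1)
    simp [gramSL, coe_matR, Matrix.mul_apply, Fin.sum_univ_two]
    ring

theorem gram_mul_u (g : G) :
    gram (g * u) = ((gram g).1, (gram g).1 + (gram g).2.1,
      (gram g).1 + 2 * (gram g).2.1 + (gram g).2.2) := by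
  induction g using QuotientGroup.induction_on with
  | H A =>
    change gramSL (A * matU) = ((gramSL A).1, (gramSL A).1 + (gramSL A).2.1,
      (gramSL A).1 + 2 * (gramSL A).2.1 + (gramSL A).2.2)
    simp [gramSL, coe_matU, Matrix.mul_apply, Fin.sum_univ_two]
    constructor <;> ring

theorem gram_mul_u_inv (g : G) :
    gram (g * u⁻¹) = ((gram g).1, (gram g).2.1 - (gram g).1,
      (gram g).1 - 2 * (gram g).2.1 + (gram g).2.2) := by
  have h := gram_mul_u (g * u⁻¹)
  rw [inv_mul_cancel_right] at h
  rw [h]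
  ext <;> simp
  ring

/-! ### Relations -/

theorem r_mul_r : r * r = 1 := by
  change ((matR * matR : SL2Z) : G) = ((1 : SL2Z) : G)
  rw [eq_comm, QuotientGroup.eq, Matrix.SpecialLinearGroup.mem_center_iff]
  refine ⟨-1, by simp, ?_⟩
  ext i j
  fin_cases i <;> fin_cases j <;> simp [coe_matR, Matrix.mul_apply, Fin.sum_univ_two]

theorem r_inv : r⁻¹ = r := inv_eq_of_mul_eq_one_left r_mul_r

theorem r_ne_one : r ≠ 1 := by
  intro h
  replace h : ((matR : SL2Z) : G) = ((1 : SL2Z) : G) := h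
  rw [eq_comm, QuotientGroup.eq, Matrix.SpecialLinearGroup.mem_center_iff] at h
  obtain ⟨t, -, h⟩ := h
  have := congrFun (congrFun h 0) 1
  rw [Matrix.scalar_apply, Matrix.diagonal_apply_ne _ (by decide)] at this
  simp [coe_matR] at this

theorem u_mul_r_mul_u : u * r * u = r * u⁻¹ * r := by
  have h : r * u * r * (u * r * u) = 1 := by
    change ((matR * matU * matR * (matU * matR * matU) : SL2Z) : G) = ((1 : SL2Z) : G)
    rw [eq_comm, QuotientGroup.eq, Matrix.SpecialLinearGroup.mem_center_iff]
    refine ⟨1, by simp, ?_⟩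
    ext i j
    fin_cases i <;> fin_cases j <;>
      simp [coe_matR, coe_matU, Matrix.mul_apply, Fin.sum_univ_two]
  rw [eq_inv_of_mul_eq_one_right h]
  simp [r_inv, mul_assoc]

/-- `u` for `true`, `u⁻¹` for `false`. -/
def letter (s : Bool) : G := if s then u else u⁻¹

theorem letter_not (s : Bool) : letter (!s) = (letter s)⁻¹ := by
  cases s <;> simp [letter]

theorem letter_mul_r_mul_letter (s : Bool) :
    letter s * r * letter s = r * (letter s)⁻¹ * r := by
  cases s
  · have h := congrArg (fun x => r * x⁻¹ * r) u_mul_r_mul_u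
    simp only [mul_inv_rev, r_inv, inv_inv] at h
    simp only [letter, Bool.false_eq_true, if_false, inv_inv]
    calc u⁻¹ * r * u⁻¹ = (r * r) * (u⁻¹ * r * u⁻¹) * (r * r) * 1 := by simp [r_mul_r]
      _ = r * (r * (u⁻¹ * (r * u⁻¹)) * r) * r := by group
      _ = r * u * r := by
        rw [h]
        simp only [mul_assoc, r_mul_r, mul_one]
        simp only [← mul_assoc, r_mul_r, one_mul]
  · simpa [letter] using u_mul_r_mul_u

theorem S_eq (s : Bool) : S = {r, letter s, (letter s)⁻¹} := by
  cases s
  · simp [S, letter, Set.pair_comm]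
  · simp [S, letter]

theorem r_mem_S : r ∈ S := by simp [S]

theorem letter_mem_S (s : Bool) : letter s ∈ S := by simp [S_eq s]

theorem inv_mem_S {c : G} (hc : c ∈ S) : c⁻¹ ∈ S := by
  rcases hc with rfl | rfl | rfl <;> simp [S, r_inv]

theorem r_ne_letter (s : Bool) : r ≠ letter s := by
  intro h
  have h1 := gram_mul_r 1
  have h2 := gram_mul_u 1
  have h3 := gram_mul_u_inv 1
  simp only [gram_one, one_mul] at h1 h2 h3
  cases s <;> simp [letter] at h <;> simp_all

theorem letter_injective : Function.Injective letter := by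
  have h2 := gram_mul_u 1
  have h3 := gram_mul_u_inv 1
  simp only [gram_one, one_mul] at h2 h3
  intro s t h
  have hgram := congrArg gram h
  cases s <;> cases t <;> first | rfl | simp [letter, h2, h3] at hgram

/-! ### Normal forms -/

/-- Every element of `PSL(2,ℤ)` is `near s m` or `near s m * r`. The list `m` records, from the
most recent one on, the moves in the tree of hexagons of the Cayley graph: `false` continues with
the letter `letter s`, and `true` crosses an edge `r` first and then uses the letter `letter s`
opposite to the previous one. -/
def near : Bool → List Bool → G
  | _, [] => 1
  | s, false :: m => near s m * letter s
  | s, true :: m => near (!s) m * r * letter s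

/-- The length of the word spelled by `near s m`. -/
def cost : List Bool → ℕ
  | [] => 0
  | false :: m => cost m + 1
  | true :: m => cost m + 2

theorem near_bounds (s : Bool) (m : List Bool) :
    0 < (gram (near s m)).1 ∧ (gram (near s m)).1 ≤ (gram (near s m)).2.2 ∧
      (if s then 0 ≤ (gram (near s m)).2.1 else (gram (near s m)).2.1 ≤ 0) ∧
      (m ≠ [] → (gram (near s m)).1 < (gram (near s m)).2.2 ∧ (gram (near s m)).2.1 ≠ 0) := by
  induction m generalizing s with
  | nil => cases s <;> simp [near, gram_one]
  | cons b m ih =>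
    have h1 := ih s
    have h2 := ih (!s)
    cases b <;> cases s <;>
      simp [near, letter, gram_mul_u, gram_mul_u_inv, gram_mul_r] at h1 h2 ⊢ <;> omega

theorem near_ne_near_mul_r (s s' : Bool) (m m' : List Bool) : near s m ≠ near s' m' * r := by
  intro h
  have h1 := near_bounds s m
  have h2 := near_bounds s' m'
  have h3 := congrArg gram h
  rw [gram_mul_r] at h3
  have hm : m = [] := by
    by_contra hm
    have := (h1.2.2.2 hm).1
    simp [h3] at this
    omega
  have hm' : m' = [] := by
    by_contra hm'
    have := (h2.2.2.2 hm').1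
    simp [h3] at h1
    omega
  subst hm hm'
  exact r_ne_one (by simpa [near] using h.symm)

theorem near_side_eq {s s' : Bool} {m m' : List Bool} (hm : m ≠ []) (h : near s m = near s' m') :
    s = s' := by
  have h1 := near_bounds s m
  have h2 := near_bounds s' m'
  have h3 := (h1.2.2.2 hm).2
  rw [h] at h1 h3
  cases s <;> cases s' <;> simp at h1 h2 ⊢ <;> omega

theorem near_ne_one (s : Bool) {m : List Bool} (hm : m ≠ []) : near s m ≠ 1 := by
  intro h
  have := ((near_bounds s m).2.2.2 hm).2
  simp [h, gram_one] at this

theorem cost_eq_of_near_eq {s s' : Bool} {m m' : List Bool} (h : near s m = near s' m') :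
    cost m = cost m' := by
  induction m generalizing s s' m' with
  | nil =>
    cases m' with
    | nil => rfl
    | cons b m' => exact absurd h.symm (near_ne_one s' (by simp))
  | cons b m ih =>
    cases m' with
    | nil => exact absurd h (near_ne_one s (by simp))
    | cons b' m' =>
      obtain rfl := near_side_eq (by simp) h
      cases b <;> cases b' <;> simp only [near, mul_left_inj] at h
      · simp [cost, ih h]
      · exact absurd h (near_ne_near_mul_r _ _ _ _)
      · exact absurd h.symm (near_ne_near_mul_r _ _ _ _)
      · simp [cost, ih h]

/-! Right multiplication of normal forms by generators. -/

theorem near_mul_letter (s : Bool) (m : List Bool) :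
    near s m * letter s = near s (false :: m) := rfl

theorem near_false_mul_inv (s : Bool) (m : List Bool) :
    near s (false :: m) * (letter s)⁻¹ = near s m := by simp [near]

theorem near_true_mul_inv (s : Bool) (m : List Bool) :
    near s (true :: m) * (letter s)⁻¹ = near (!s) m * r := by simp [near]

theorem far_mul_inv (s : Bool) (m : List Bool) :
    near s m * r * (letter s)⁻¹ = near (!s) (true :: m) := by simp [near, letter_not]

theorem far_false_mul_letter (s : Bool) (m : List Bool) :
    near s (false :: m) * r * letter s = near (!s) (true :: m) * r := by
  have h := congrArg (near s m * ·) (letter_mul_r_mul_letter s)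
  simpa [near, letter_not, mul_assoc] using h

theorem far_true_mul_letter (s : Bool) (m : List Bool) :
    near s (true :: m) * r * letter s = near (!s) (false :: m) * r := by
  have h := congrArg (near (!s) m * r * ·) (letter_mul_r_mul_letter s)
  have hr (x : G) : r * (r * x) = x := by rw [← mul_assoc, r_mul_r, one_mul]
  simpa [near, letter_not, mul_assoc, hr] using h

theorem near_nil (s s' : Bool) : near s [] = near s' [] := rfl

theorem far_mul_r (s : Bool) (m : List Bool) : near s m * r * r = near s m := by
  rw [mul_assoc, r_mul_r, mul_one]

/-! ### Word norm of normal forms -/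

/-- `g` is represented by some word in `S`. -/
def HasWord (g : G) : Prop := ∃ w : List G, IsWord w ∧ w.prod = g

theorem isWord_append {w v : List G} : IsWord (w ++ v) ↔ IsWord w ∧ IsWord v := by
  simp only [IsWord, List.mem_append, or_imp, forall_and]

theorem isWord_singleton {c : G} : IsWord [c] ↔ c ∈ S := by simp [IsWord]

theorem wordNorm_le {w : List G} (hw : IsWord w) : wordNorm w.prod ≤ w.length :=
  Nat.sInf_le ⟨w, hw, rfl, rfl⟩

theorem HasWord.exists_geodesic {g : G} (hg : HasWord g) : ∃ w, IsGeodesic g w := by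
  obtain ⟨w, hw, hwg⟩ := hg
  obtain ⟨v, hv, hvg, hl⟩ := Nat.sInf_mem
    (s := {n | ∃ w : List G, IsWord w ∧ w.prod = g ∧ w.length = n}) ⟨_, w, hw, hwg, rfl⟩
  exact ⟨v, hv, hvg, hl⟩

theorem HasWord.mul {g c : G} (hg : HasWord g) (hc : c ∈ S) : HasWord (g * c) := by
  obtain ⟨w, hw, rfl⟩ := hg
  exact ⟨w ++ [c], isWord_append.2 ⟨hw, isWord_singleton.2 hc⟩, by simp⟩

theorem HasWord.wordNorm_mul_le {g c : G} (hg : HasWord g) (hc : c ∈ S) :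
    wordNorm (g * c) ≤ wordNorm g + 1 := by
  obtain ⟨w, hw, hwg, hl⟩ := hg.exists_geodesic
  have := wordNorm_le (isWord_append.2 ⟨hw, isWord_singleton.2 hc⟩)
  simpa [hwg, hl] using this

theorem exists_word_near (s : Bool) (m : List Bool) :
    ∃ w : List G, IsWord w ∧ w.prod = near s m ∧ w.length = cost m := by
  induction m generalizing s with
  | nil => exact ⟨[], by simp [IsWord], by simp [near], rfl⟩
  | cons b m ih =>
    cases b
    · obtain ⟨w, hw, hp, hl⟩ := ih s
      exact ⟨w ++ [letter s], isWord_append.2 ⟨hw, isWord_singleton.2 (letter_mem_S s)⟩,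
        by simp [near, hp], by simp [cost, hl]⟩
    · obtain ⟨w, hw, hp, hl⟩ := ih (!s)
      exact ⟨w ++ [r] ++ [letter s], isWord_append.2 ⟨isWord_append.2
        ⟨hw, isWord_singleton.2 r_mem_S⟩, isWord_singleton.2 (letter_mem_S s)⟩,
        by simp [near, hp, mul_assoc], by simp [cost, hl]⟩

theorem exists_normal_form (w : List G) (hw : IsWord w) :
    ∃ s m, (w.prod = near s m ∧ cost m ≤ w.length) ∨
      (w.prod = near s m * r ∧ cost m + 1 ≤ w.length) := by
  induction w using List.reverseRecOn with
  | nil => exact ⟨true, [], Or.inl ⟨rfl, le_rfl⟩⟩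
  | append_singleton w c ih =>
    rw [isWord_append, isWord_singleton] at hw
    obtain ⟨s, m, ⟨hp, hl⟩ | ⟨hp, hl⟩⟩ := ih hw.1
    all_goals
      have hc := hw.2
      rw [S_eq s] at hc
      simp only [List.prod_append, List.prod_singleton, List.length_append, List.length_singleton,
        hp]
    · rcases hc with rfl | rfl | rfl
      · exact ⟨s, m, Or.inr ⟨rfl, by omega⟩⟩
      · exact ⟨s, false :: m, Or.inl ⟨rfl, by simp [cost, hl]⟩⟩
      · match m with
        | [] => exact ⟨!s, [false], Or.inl ⟨by simp [near, letter_not], by simp [cost]⟩⟩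
        | false :: m =>
          exact ⟨s, m, Or.inl ⟨near_false_mul_inv s m, by simp [cost] at hl; omega⟩⟩
        | true :: m =>
          exact ⟨!s, m, Or.inr ⟨near_true_mul_inv s m, by simp [cost] at hl; omega⟩⟩
    · rcases hc with rfl | rfl | rfl
      · exact ⟨s, m, Or.inl ⟨far_mul_r s m, by omega⟩⟩
      · match m with
        | [] => exact ⟨s, [true], Or.inl ⟨by simp [near], by simp [cost] at hl ⊢; omega⟩⟩
        | false :: m =>
          exact ⟨!s, true :: m, Or.inr ⟨far_false_mul_letter s m, by simp [cost] at hl ⊢; omega⟩⟩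
        | true :: m =>
          exact ⟨!s, false :: m, Or.inr ⟨far_true_mul_letter s m, by simp [cost] at hl ⊢; omega⟩⟩
      · exact ⟨!s, true :: m, Or.inl ⟨far_mul_inv s m, by simp [cost]; omega⟩⟩

theorem hasWord_near (s : Bool) (m : List Bool) : HasWord (near s m) := by
  obtain ⟨w, hw, hp, -⟩ := exists_word_near s m
  exact ⟨w, hw, hp⟩

theorem hasWord_far (s : Bool) (m : List Bool) : HasWord (near s m * r) :=
  (hasWord_near s m).mul r_mem_S

theorem wordNorm_near (s : Bool) (m : List Bool) : wordNorm (near s m) = cost m := by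
  apply le_antisymm
  · obtain ⟨w, hw, hp, hl⟩ := exists_word_near s m
    rw [← hp, ← hl]
    exact wordNorm_le hw
  · obtain ⟨w, hw, hp, hl⟩ := (hasWord_near s m).exists_geodesic
    obtain ⟨s', m', ⟨h, hc⟩ | ⟨h, hc⟩⟩ := exists_normal_form w hw
    · rw [← hl, cost_eq_of_near_eq (hp.symm.trans h)]
      exact hc
    · exact absurd (hp.symm.trans h) (near_ne_near_mul_r _ _ _ _)

theorem wordNorm_far (s : Bool) (m : List Bool) : wordNorm (near s m * r) = cost m + 1 := by
  apply le_antisymm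
  · rw [← wordNorm_near s m]
    exact (hasWord_near s m).wordNorm_mul_le r_mem_S
  · obtain ⟨w, hw, hp, hl⟩ := (hasWord_far s m).exists_geodesic
    obtain ⟨s', m', ⟨h, hc⟩ | ⟨h, hc⟩⟩ := exists_normal_form w hw
    · exact absurd (h.symm.trans hp) (near_ne_near_mul_r _ _ _ _)
    · rw [← hl, cost_eq_of_near_eq (mul_right_cancel (hp.symm.trans h))]
      exact hc

/-! ### Last letters of geodesics -/

/-- The last letters of geodesics for `g`. -/
def lastLetters (g : G) : Set G := {c ∈ S | wordNorm (g * c⁻¹) + 1 = wordNorm g}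

theorem HasWord.mem_suf_two {g : G} (hg : HasWord g) {v : List G} :
    v ∈ Suf 2 g ↔ ∃ b c, v = [b, c] ∧ c ∈ lastLetters g ∧ b ∈ lastLetters (g * c⁻¹) := by
  constructor
  · rintro ⟨hv, w, ⟨hw, hp, hl⟩, t, rfl⟩
    obtain ⟨b, c, rfl⟩ := List.length_eq_two.1 hv
    have hwt : IsWord t := (isWord_append.1 hw).1
    have hb : b ∈ S := hw b (by simp)
    have hc : c ∈ S := hw c (by simp)
    have h1 : g * c⁻¹ * b⁻¹ = t.prod := by simp [← hp, mul_assoc]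
    have h2 := wordNorm_le hwt
    have h3 := (hg.mul (inv_mem_S hc)).wordNorm_mul_le hc
    have h4 := ((hg.mul (inv_mem_S hc)).mul (inv_mem_S hb)).wordNorm_mul_le hb
    rw [inv_mul_cancel_right] at h3 h4
    rw [← h1] at h2
    simp only [List.length_append, List.length_cons, List.length_nil] at hl
    exact ⟨b, c, rfl, ⟨hc, by omega⟩, hb, by omega⟩
  · rintro ⟨b, c, rfl, ⟨hc, hc'⟩, hb, hb'⟩
    obtain ⟨t, ht, hp, hl⟩ :=
      ((hg.mul (inv_mem_S hc)).mul (inv_mem_S hb)).exists_geodesic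
    refine ⟨rfl, t ++ [b, c], ⟨?_, by simp [hp], ?_⟩, t, rfl⟩
    · refine isWord_append.2 ⟨ht, ?_⟩
      simp [IsWord, hb, hc]
    · simp only [List.length_append, List.length_cons, List.length_nil]
      omega

theorem lastLetters_eq (s : Bool) (g : G) :
    lastLetters g = {c | (c = r ∧ wordNorm (g * r) + 1 = wordNorm g) ∨
      (c = letter s ∧ wordNorm (g * (letter s)⁻¹) + 1 = wordNorm g) ∨
      (c = (letter s)⁻¹ ∧ wordNorm (g * letter s) + 1 = wordNorm g)} := by
  ext c
  simp only [lastLetters, S_eq s, Set.mem_ofPred_eq, Set.mem_insert_iff, Set.mem_singleton_iff]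
  constructor
  · rintro ⟨rfl | rfl | rfl, h⟩
    · exact Or.inl ⟨rfl, by rwa [r_inv] at h⟩
    · exact Or.inr (Or.inl ⟨rfl, h⟩)
    · exact Or.inr (Or.inr ⟨rfl, by rwa [inv_inv] at h⟩)
  · rintro (⟨rfl, h⟩ | ⟨rfl, h⟩ | ⟨rfl, h⟩)
    · exact ⟨Or.inl rfl, by rwa [r_inv]⟩
    · exact ⟨Or.inr (Or.inl rfl), h⟩
    · exact ⟨Or.inr (Or.inr rfl), by rwa [inv_inv]⟩

theorem lastLetters_one : lastLetters 1 = ∅ := by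
  have h : wordNorm 1 = 0 := wordNorm_near true []
  simp [lastLetters, h]

theorem lastLetters_near (s b : Bool) (m : List Bool) :
    lastLetters (near s (b :: m)) = {letter s} := by
  ext c
  rw [lastLetters_eq s, Set.mem_ofPred_eq, wordNorm_far, near_mul_letter, wordNorm_near,
    wordNorm_near]
  cases b
  · rw [near_false_mul_inv, wordNorm_near]
    have h : cost m + 1 + 1 ≠ cost m := by omega
    simp [cost, h]
  · rw [near_true_mul_inv, wordNorm_far]
    simp [cost]

theorem lastLetters_near_subset (s : Bool) (m : List Bool) :
    lastLetters (near s m) ⊆ {letter s} := by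
  cases m with
  | nil => simp [near, lastLetters_one]
  | cons b m => rw [lastLetters_near]

theorem lastLetters_far_nil (s : Bool) : lastLetters (near s [] * r) = {r} := by
  ext c
  rw [lastLetters_eq s, Set.mem_ofPred_eq, far_mul_r, far_mul_inv, near_nil s (!s),
    show near (!s) [] * r * letter s = near s [true] from rfl]
  simp only [wordNorm_near, wordNorm_far]
  simp [cost]

theorem lastLetters_far_false (s : Bool) (m : List Bool) :
    lastLetters (near s (false :: m) * r) = {r} := by
  ext c
  rw [lastLetters_eq s, Set.mem_ofPred_eq, far_mul_r, far_mul_inv, far_false_mul_letter]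
  simp only [wordNorm_near, wordNorm_far]
  simp [cost]

theorem lastLetters_far_true (s : Bool) (m : List Bool) :
    lastLetters (near s (true :: m) * r) = {r, (letter s)⁻¹} := by
  ext c
  rw [lastLetters_eq s, Set.mem_ofPred_eq, far_mul_r, far_mul_inv, far_true_mul_letter]
  simp only [wordNorm_near, wordNorm_far]
  simp [cost]

theorem mem_lastLetters_far {s : Bool} {m : List Bool} {t : Bool}
    (h : letter t ∈ lastLetters (near s m * r)) :
    t = !s ∧ ∃ m', m = true :: m' := by
  match m with
  | [] =>
    rw [lastLetters_far_nil] at h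
    exact absurd h.symm (r_ne_letter t)
  | false :: m =>
    rw [lastLetters_far_false] at h
    exact absurd h.symm (r_ne_letter t)
  | true :: m =>
    rw [lastLetters_far_true, ← letter_not] at h
    rcases h with h | h
    · exact absurd h.symm (r_ne_letter t)
    · exact ⟨letter_injective h, m, rfl⟩

theorem suf2Star_eq_of_suf_two {g : G} {v : List G} {A : Set (List G)} (h : Suf 2 g = A)
    (hv : v ∈ A) : Suf2Star g = A := by
  rw [Suf2Star, if_pos (h ▸ ⟨v, hv⟩), h]

theorem mem_suf_of_suf2Star {g : G} {v : List G} (hv : v.length = 2) (h : v ∈ Suf2Star g) :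
    v ∈ Suf 2 g := by
  rw [Suf2Star] at h
  split_ifs at h with h'
  · exact h
  · have := h.1
    omega

/-- The normal form of the elements some of whose geodesics end in `ra` and some in `aa`. -/
theorem exists_near_of_mem_suf {g : G} {t : Bool} (h1 : [r, letter t] ∈ Suf 2 g)
    (h2 : [letter t, letter t] ∈ Suf 2 g) : ∃ m, g = near t (true :: true :: m) := by
  obtain ⟨-, w, ⟨hw, rfl, -⟩, -⟩ := id h1
  have hW : HasWord w.prod := ⟨w, hw, rfl⟩
  obtain ⟨b, c, hbc, hc, hb1⟩ := hW.mem_suf_two.1 h1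
  obtain ⟨rfl, rfl⟩ : r = b ∧ letter t = c := by simpa using hbc
  obtain ⟨b, c, hbc, -, hb2⟩ := hW.mem_suf_two.1 h2
  obtain ⟨rfl, rfl⟩ : letter t = b ∧ letter t = c := by simpa using hbc
  obtain ⟨s, m, ⟨hg, -⟩ | ⟨hg, -⟩⟩ := exists_normal_form w hw
  · rw [hg] at hc hb1 hb2 ⊢
    obtain rfl := letter_injective (lastLetters_near_subset s m hc)
    match m with
    | [] =>
      rw [near, lastLetters_one] at hc
      exact hc.elim
    | false :: m =>
      rw [near_false_mul_inv] at hb1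
      exact absurd (lastLetters_near_subset _ _ hb1) (r_ne_letter _)
    | true :: m =>
      rw [near_true_mul_inv] at hb2
      obtain ⟨-, m', rfl⟩ := mem_lastLetters_far hb2
      exact ⟨m', rfl⟩
  · rw [hg] at hc hb2
    obtain ⟨rfl, m', rfl⟩ := mem_lastLetters_far hc
    rw [letter_not, inv_inv, far_true_mul_letter, ← letter_not] at hb2
    obtain ⟨-, _, h⟩ := mem_lastLetters_far hb2
    simp at h

/-- If `𝐒₂*(g) = {ra, aa}` (for `a = u` or `u⁻¹`) then `S⁺(g) = {r, a}`,
`𝐒₂*(g·r) = {ar, rā}` and `𝐒₂*(g·a) = {aa}`. -/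
theorem type_ra_aa (a : G) (ha : a ∈ ({u, u⁻¹} : Set G))
    (g : G) (hg : Suf2Star g = ({[r, a], [a, a]} : Set (List G))) :
    Splus g = {r, a} ∧
      Suf2Star (g * r) = {[a, r], [r, a⁻¹]} ∧
      Suf2Star (g * a) = {[a, a]} := by
  obtain ⟨t, rfl⟩ : ∃ t, a = letter t := by
    rcases ha with rfl | rfl
    exacts [⟨true, rfl⟩, ⟨false, rfl⟩]
  obtain ⟨m, rfl⟩ := exists_near_of_mem_suf (g := g) (t := t)
    (mem_suf_of_suf2Star rfl (by simp [hg])) (mem_suf_of_suf2Star rfl (by simp [hg]))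
  refine ⟨?_, ?_, ?_⟩
  · ext c
    rw [Splus, S_eq t]
    simp only [Set.mem_ofPred_eq, Set.mem_insert_iff, Set.mem_singleton_iff]
    constructor
    · rintro ⟨rfl | rfl | rfl, h⟩
      · exact Or.inl rfl
      · exact Or.inr rfl
      · rw [near_true_mul_inv, wordNorm_far, wordNorm_near] at h
        simp [cost] at h
    · rintro (rfl | rfl)
      · exact ⟨Or.inl rfl, by rw [wordNorm_far, wordNorm_near]⟩
      · exact ⟨Or.inr (Or.inl rfl), by rw [near_mul_letter, wordNorm_near, wordNorm_near, cost]⟩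
  · refine suf2Star_eq_of_suf_two (v := [letter t, r]) ?_ (by simp)
    ext v
    rw [(hasWord_far _ _).mem_suf_two, lastLetters_far_true]
    constructor
    · rintro ⟨b, c, rfl, rfl | rfl, hb⟩
      · rw [r_inv, far_mul_r, lastLetters_near] at hb
        obtain rfl := hb
        simp
      · rw [inv_inv, far_true_mul_letter, lastLetters_far_false] at hb
        obtain rfl := hb
        simp
    · rintro (rfl | rfl)
      · refine ⟨_, _, rfl, by simp, ?_⟩
        rw [r_inv, far_mul_r, lastLetters_near]
        rfl
      · refine ⟨_, _, rfl, by simp, ?_⟩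
        rw [inv_inv, far_true_mul_letter, lastLetters_far_false]
        rfl
  · refine suf2Star_eq_of_suf_two (v := [letter t, letter t]) ?_ rfl
    ext v
    rw [near_mul_letter, (hasWord_near _ _).mem_suf_two, lastLetters_near]
    constructor
    · rintro ⟨b, c, rfl, rfl, hb⟩
      rw [near_false_mul_inv, lastLetters_near] at hb
      obtain rfl := hb
      rfl
    · rintro rfl
      refine ⟨_, _, rfl, rfl, ?_⟩
      rw [near_false_mul_inv, lastLetters_near]
      rfl

end PSL2Z
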